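/- Let n ≥ 2 and 1 ≤ p ≤ n−1. Let Y ∈ ℝ^{n×n} be symmetric and suppose there exists X ∈ Gr(p,n) with ‖Y − X‖ < 1/√2 (Frobenius norm). Then λ_p(Y) > λ_{p+1}(Y), where λ₁(Y) ≥ λ₂(Y) ≥ … ≥ λ_n(Y) denote the eigenvalues of Y in decreasing order counted with multiplicity. Consequently, the projection of Y onto Gr(p,n) is unique. -/

import Mathlib

open Matrix

/-- Frobenius norm of a real matrix: `‖A‖ = √(trace (Aᵀ * A))`. -/
noncomputable def frobNorm {m n : ℕ} (A : Matrix (Fin m) (Fin n) ℝ) : ℝ :=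
  Real.sqrt (Matrix.trace (Aᵀ * A))

/-- The Grassmann manifold `Gr(p,n)` of rank-`p` orthogonal projection matrices. -/
def Grass {n : ℕ} (p : ℕ) (X : Matrix (Fin n) (Fin n) ℝ) : Prop :=
  X.IsSymm ∧ X * X = X ∧ X.rank = p

lemma frobNorm_sq {m n : ℕ} (A : Matrix (Fin m) (Fin n) ℝ) :
    frobNorm A ^ 2 = (Aᵀ * A).trace := by
  refine Real.sq_sqrt ?_
  simp only [trace, diag_apply, mul_apply, transpose_apply]
  exact Finset.sum_nonneg fun _ _ => Finset.sum_nonneg fun _ _ => mul_self_nonneg _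

lemma frobNorm_nonneg {m n : ℕ} (A : Matrix (Fin m) (Fin n) ℝ) : 0 ≤ frobNorm A :=
  Real.sqrt_nonneg _

lemma eq_zero_of_frobNorm_sq_eq_zero {m n : ℕ} {A : Matrix (Fin m) (Fin n) ℝ}
    (h : frobNorm A ^ 2 = 0) : A = 0 := by
  rw [frobNorm_sq, ← conjTranspose_eq_transpose_of_trivial] at h
  exact trace_conjTranspose_mul_self_eq_zero_iff.mp h

lemma frobNorm_conj {n : ℕ} {Q : Matrix (Fin n) (Fin n) ℝ} (hQ : Qᵀ * Q = 1)
    (A : Matrix (Fin n) (Fin n) ℝ) : frobNorm (Q * A * Qᵀ) = frobNorm A := by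
  have h : (Q * A * Qᵀ)ᵀ * (Q * A * Qᵀ) = Q * (Aᵀ * A * Qᵀ) := by
    calc (Q * A * Qᵀ)ᵀ * (Q * A * Qᵀ) = Q * (Aᵀ * ((Qᵀ * Q) * (A * Qᵀ))) := by
          simp only [transpose_mul, transpose_transpose, Matrix.mul_assoc]
      _ = _ := by rw [hQ, Matrix.one_mul, ← Matrix.mul_assoc Aᵀ]
  rw [frobNorm, frobNorm, h, trace_mul_comm, Matrix.mul_assoc, hQ, Matrix.mul_one]

namespace Grass

variable {n p : ℕ} {X : Matrix (Fin n) (Fin n) ℝ}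

lemma conj {Q : Matrix (Fin n) (Fin n) ℝ} (hQ : Qᵀ * Q = 1) (hX : Grass p X) :
    Grass p (Q * X * Qᵀ) := by
  obtain ⟨hsymm, hidem, hrank⟩ := hX
  refine ⟨?_, ?_, ?_⟩
  · simp only [IsSymm, transpose_mul, transpose_transpose, hsymm.eq, Matrix.mul_assoc]
  · calc Q * X * Qᵀ * (Q * X * Qᵀ) = Q * (X * ((Qᵀ * Q) * (X * Qᵀ))) := by
          simp only [Matrix.mul_assoc]
      _ = Q * (X * X * Qᵀ) := by rw [hQ, Matrix.one_mul, ← Matrix.mul_assoc X]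
      _ = Q * X * Qᵀ := by rw [hidem, Matrix.mul_assoc]
  · rw [rank_mul_eq_left_of_isUnit_det _ _ (isUnit_det_of_right_inverse hQ),
      rank_mul_eq_right_of_isUnit_det _ _ (isUnit_det_of_left_inverse hQ), hrank]

lemma trace_eq (hX : Grass p X) : X.trace = p := by
  obtain ⟨-, hidem, hrank⟩ := hX
  have hf : IsIdempotentElem (toLin' X) := by
    rw [IsIdempotentElem, Module.End.mul_eq_comp, ← toLin'_mul, hidem]
  rw [← trace_toLin'_eq, ((LinearMap.isProj_range_iff_isIdempotentElem _).mpr hf).trace,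
    ← hrank, rank, toLin'_apply']

lemma apply_self (hX : Grass p X) (i : Fin n) : X i i = ∑ j, X i j ^ 2 := by
  conv_lhs => rw [← hX.2.1, mul_apply]
  exact Finset.sum_congr rfl fun j _ => by rw [hX.1.apply i j, sq]

lemma apply_self_nonneg (hX : Grass p X) (i : Fin n) : 0 ≤ X i i := by
  rw [hX.apply_self]
  positivity

lemma apply_self_le_one (hX : Grass p X) (i : Fin n) : X i i ≤ 1 := by
  have h : X i i ^ 2 ≤ X i i := by
    conv_rhs => rw [hX.apply_self]
    exact Finset.single_le_sum (f := fun j => X i j ^ 2) (fun j _ => sq_nonneg _)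
      (Finset.mem_univ i)
  nlinarith

lemma frobNorm_diagonal_sub_sq (hX : Grass p X) (μ : Fin n → ℝ) :
    frobNorm (diagonal μ - X) ^ 2 = ∑ i, μ i ^ 2 - 2 * ∑ i, μ i * X i i + p := by
  have h : (diagonal μ - X)ᵀ * (diagonal μ - X) =
      diagonal μ * diagonal μ - diagonal μ * X - X * diagonal μ + X := by
    rw [transpose_sub, diagonal_transpose, hX.1.eq, sub_mul, mul_sub, mul_sub, hX.2.1]
    abel
  rw [frobNorm_sq, h, trace_add, trace_sub, trace_sub, trace_mul_comm X, hX.trace_eq,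
    diagonal_mul_diagonal, trace_diagonal]
  simp only [trace, diag_apply, diagonal_mul, sq]
  ring

end Grass

/-- The indicator of the first `p` indices. -/
def firstIndicator (n p : ℕ) (i : Fin n) : ℝ := if (i : ℕ) < p then 1 else 0

lemma firstIndicator_mul_self {n p : ℕ} (i : Fin n) :
    firstIndicator n p i * firstIndicator n p i = firstIndicator n p i := by
  unfold firstIndicator; split_ifs <;> simp

lemma grass_diagonal_firstIndicator {n p : ℕ} (h : p ≤ n) :
    Grass p (diagonal (firstIndicator n p)) := by
  refine ⟨diagonal_transpose _, ?_, ?_⟩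
  · simp only [diagonal_mul_diagonal, firstIndicator_mul_self]
  · rw [rank_diagonal, Fintype.card_subtype]
    simp [firstIndicator, Fin.card_filter_val_lt, h]

/-- The squared distance from a diagonal matrix to a point of the Grassmannian, compared with
the squared distance to the coordinate projection onto the first `p` axes. -/
lemma Grass.frobNorm_diagonal_sub_sq_eq {n p : ℕ} {X : Matrix (Fin n) (Fin n) ℝ}
    (hX : Grass p X) (hpn : p ≤ n) (μ : Fin n → ℝ) (c : ℝ) :
    frobNorm (diagonal μ - X) ^ 2 =
      frobNorm (diagonal μ - diagonal (firstIndicator n p)) ^ 2 +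
        2 * ∑ i, (μ i - c) * (firstIndicator n p i - X i i) := by
  have hE := grass_diagonal_firstIndicator hpn
  have hXt := hX.trace_eq
  have hEt := hE.trace_eq
  rw [hX.frobNorm_diagonal_sub_sq, hE.frobNorm_diagonal_sub_sq]
  simp only [trace, diag_apply, diagonal_apply_eq] at hXt hEt ⊢
  have : ∑ i, (μ i - c) * (firstIndicator n p i - X i i) =
      ∑ i, μ i * firstIndicator n p i - ∑ i, μ i * X i i
        - c * (∑ i, firstIndicator n p i - ∑ i, X i i) := by
    rw [← Finset.sum_sub_distrib, ← Finset.sum_sub_distrib, Finset.mul_sum,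
      ← Finset.sum_sub_distrib]
    exact Finset.sum_congr rfl fun i _ => by ring
  rw [this, hXt, hEt]
  ring

lemma Grass.mul_firstIndicator_sub_nonneg {n p : ℕ} {X : Matrix (Fin n) (Fin n) ℝ}
    (hX : Grass p X) {μ : Fin n → ℝ} {c : ℝ} (hlt : ∀ i : Fin n, (i : ℕ) < p → c ≤ μ i)
    (hge : ∀ i : Fin n, p ≤ (i : ℕ) → μ i ≤ c) (i : Fin n) :
    0 ≤ (μ i - c) * (firstIndicator n p i - X i i) := by
  have h0 := hX.apply_self_nonneg i
  have h1 := hX.apply_self_le_one i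
  unfold firstIndicator
  split_ifs with hi
  · exact mul_nonneg (by linarith [hlt i hi]) (by linarith)
  · exact mul_nonneg_of_nonpos_of_nonpos (by linarith [hge i (not_lt.mp hi)]) (by linarith)

/-- A diagonal matrix whose entries at the indices `p - 1` and `p` are equal is at distance at
least `1 / √2` from the coordinate projection onto the first `p` axes. -/
lemma half_le_frobNorm_diagonal_sub_sq {n p : ℕ} {μ : Fin n → ℝ} {i j : Fin n}
    (hi : (i : ℕ) < p) (hj : p ≤ (j : ℕ)) (h : μ i = μ j) :
    1 / 2 ≤ frobNorm (diagonal μ - diagonal (firstIndicator n p)) ^ 2 := by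
  rw [frobNorm_sq, diagonal_sub, diagonal_transpose, diagonal_mul_diagonal, trace_diagonal]
  have hij : i ≠ j := by rintro rfl; omega
  have hle := Finset.sum_le_sum_of_subset_of_nonneg
    (f := fun k => (μ k - firstIndicator n p k) * (μ k - firstIndicator n p k))
    (Finset.subset_univ {i, j}) fun k _ _ => mul_self_nonneg _
  rw [Finset.sum_pair hij] at hle
  refine le_trans ?_ hle
  simp only [firstIndicator, hi, not_lt.mpr hj, if_true, if_false, h]
  nlinarith [sq_nonneg (2 * μ j - 1)]

lemma frobNorm_conj_sub {n : ℕ} {Q : Matrix (Fin n) (Fin n) ℝ} (hQ : Qᵀ * Q = 1)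
    (A X : Matrix (Fin n) (Fin n) ℝ) :
    frobNorm (Q * A * Qᵀ - X) = frobNorm (A - Qᵀ * X * Q) := by
  have hQ' : Q * Qᵀ = 1 := mul_eq_one_comm.mp hQ
  rw [← frobNorm_conj hQ (A - Qᵀ * X * Q), mul_sub, sub_mul]
  congr 2
  calc X = (Q * Qᵀ) * X * (Q * Qᵀ) := by rw [hQ', Matrix.one_mul, Matrix.mul_one]
    _ = Q * (Qᵀ * X * Q) * Qᵀ := by simp only [Matrix.mul_assoc]

lemma Grass.transpose_conj {n p : ℕ} {Q X : Matrix (Fin n) (Fin n) ℝ} (hQ : Qᵀ * Q = 1)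
    (hX : Grass p X) : Grass p (Qᵀ * X * Q) := by
  simpa using hX.conj (Q := Qᵀ) (by simpa using mul_eq_one_comm.mp hQ)

/-- A real symmetric matrix has a spectral decomposition with decreasing eigenvalues. -/
lemma exists_antitone_spectral_decomposition {n : ℕ} {Y : Matrix (Fin n) (Fin n) ℝ}
    (hY : Y.IsSymm) : ∃ (Q : Matrix (Fin n) (Fin n) ℝ) (μ : Fin n → ℝ),
      Qᵀ * Q = 1 ∧ Antitone μ ∧ Y = Q * diagonal μ * Qᵀ := by
  have hH : Y.IsHermitian := by
    rw [IsHermitian, conjTranspose_eq_transpose_of_trivial, hY.eq]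
  set U : Matrix (Fin n) (Fin n) ℝ := hH.eigenvectorUnitary.1
  have hUU : Uᵀ * U = 1 := by
    have := Unitary.coe_star_mul_self hH.eigenvectorUnitary
    rwa [star_eq_conjTranspose, conjTranspose_eq_transpose_of_trivial] at this
  have hYU : Y = U * diagonal hH.eigenvalues * Uᵀ := by
    have := hH.spectral_theorem
    rw [Unitary.conjStarAlgAut_apply, star_eq_conjTranspose,
      conjTranspose_eq_transpose_of_trivial] at this
    exact this
  set σ : Equiv.Perm (Fin n) := Tuple.sort (fun i => -hH.eigenvalues i)
  refine ⟨U.submatrix id σ, hH.eigenvalues ∘ σ, ?_, ?_, ?_⟩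
  · rw [transpose_submatrix, submatrix_mul _ _ _ _ _ Function.bijective_id |>.symm, hUU,
      submatrix_one_equiv]
  · exact fun i j hij => neg_le_neg_iff.mp
      (Tuple.monotone_sort (fun i => -hH.eigenvalues i) hij)
  · rw [← submatrix_diagonal_equiv, transpose_submatrix, submatrix_mul_equiv,
      submatrix_mul_equiv, submatrix_id_id, ← hYU]

/-- If the ordered eigenvalues have a gap after the index `p`, then a nearest point in the
Grassmannian is the spectral projection for the `p` largest eigenvalues. -/
lemma Grass.eq_of_forall_frobNorm_le {n p : ℕ} {Q X : Matrix (Fin n) (Fin n) ℝ}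
    {μ : Fin n → ℝ} (hQ : Qᵀ * Q = 1) (hpn : p ≤ n) {c : ℝ}
    (hlt : ∀ i : Fin n, (i : ℕ) < p → c < μ i) (hge : ∀ i : Fin n, p ≤ (i : ℕ) → μ i < c)
    (hX : Grass p X)
    (hmin : ∀ Z, Grass p Z →
      frobNorm (Q * diagonal μ * Qᵀ - X) ≤ frobNorm (Q * diagonal μ * Qᵀ - Z)) :
    X = Q * diagonal (firstIndicator n p) * Qᵀ := by
  have hE := grass_diagonal_firstIndicator hpn
  have hZ := hX.transpose_conj hQ
  have hQ' : Q * Qᵀ = 1 := mul_eq_one_comm.mp hQ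
  have hle := hmin _ (hE.conj hQ)
  rw [frobNorm_conj_sub hQ, ← sub_mul, ← mul_sub, frobNorm_conj hQ] at hle
  have hsq := pow_le_pow_left₀ (frobNorm_nonneg _) hle 2
  rw [hZ.frobNorm_diagonal_sub_sq_eq hpn μ c] at hsq
  set Z := Qᵀ * X * Q with hZdef
  have hnonneg := hZ.mul_firstIndicator_sub_nonneg (fun i hi => (hlt i hi).le)
    (fun i hi => (hge i hi).le)
  have hsum : ∑ i, (μ i - c) * (firstIndicator n p i - Z i i) = 0 :=
    le_antisymm (by linarith) (Finset.sum_nonneg fun i _ => hnonneg i)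
  have hdiag : ∀ i, Z i i = firstIndicator n p i := fun i => by
    have h0 := (Finset.sum_eq_zero_iff_of_nonneg fun i _ => hnonneg i).mp hsum i
      (Finset.mem_univ i)
    have hne : μ i - c ≠ 0 := by
      rcases lt_or_ge (i : ℕ) p with hi | hi
      · exact (sub_pos.mpr (hlt i hi)).ne'
      · exact (sub_neg.mpr (hge i hi)).ne
    linarith [(mul_eq_zero.mp h0).resolve_left hne]
  have hZE : diagonal (firstIndicator n p) = Z := by
    refine sub_eq_zero.mp (eq_zero_of_frobNorm_sq_eq_zero ?_)
    have htr := hE.trace_eq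
    rw [trace_diagonal] at htr
    simp only [hZ.frobNorm_diagonal_sub_sq, hdiag, firstIndicator_mul_self, sq, htr]
    ring
  rw [hZE, hZdef]
  calc X = (Q * Qᵀ) * X * (Q * Qᵀ) := by rw [hQ', Matrix.one_mul, Matrix.mul_one]
    _ = Q * (Qᵀ * X * Q) * Qᵀ := by simp only [Matrix.mul_assoc]

/-- Example 4.7 (key eigengap claim): if a symmetric `Y` is within Frobenius
distance `1/√2` of `Gr(p,n)` (with `1 ≤ p ≤ n−1`), then its `p`-th largest
eigenvalue strictly exceeds its `(p+1)`-th largest eigenvalue (stated for any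
spectral decomposition `Y = Q·diag(μ)·Qᵀ` with `μ` in decreasing order), and
consequently the projection of `Y` onto `Gr(p,n)` is unique. -/
theorem grassmann_eigengap_of_close {n p : ℕ} (hn : 2 ≤ n) (hp1 : 1 ≤ p)
    (hpn : p ≤ n - 1)
    (Y : Matrix (Fin n) (Fin n) ℝ) (hY : Y.IsSymm)
    (hclose : ∃ X, Grass p X ∧ frobNorm (Y - X) < 1 / Real.sqrt 2) :
    (∀ (Q : Matrix (Fin n) (Fin n) ℝ) (μ : Fin n → ℝ),
        Qᵀ * Q = 1 → Antitone μ → Y = Q * Matrix.diagonal μ * Qᵀ →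
        μ ⟨p, by omega⟩ < μ ⟨p - 1, by omega⟩) ∧
    (∀ X₁ X₂ : Matrix (Fin n) (Fin n) ℝ, Grass p X₁ → Grass p X₂ →
        (∀ X, Grass p X → frobNorm (Y - X₁) ≤ frobNorm (Y - X)) →
        (∀ X, Grass p X → frobNorm (Y - X₂) ≤ frobNorm (Y - X)) →
        X₁ = X₂) := by
  have hpn' : p ≤ n := by omega
  have hgap : ∀ (Q : Matrix (Fin n) (Fin n) ℝ) (μ : Fin n → ℝ),
      Qᵀ * Q = 1 → Antitone μ → Y = Q * Matrix.diagonal μ * Qᵀ →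
      μ ⟨p, by omega⟩ < μ ⟨p - 1, by omega⟩ := by
    rintro Q μ hQ hμ rfl
    obtain ⟨X, hX, hlt⟩ := hclose
    have hZ := hX.transpose_conj hQ
    rw [frobNorm_conj_sub hQ] at hlt
    have hsq := pow_lt_pow_left₀ hlt (frobNorm_nonneg _) two_ne_zero
    rw [div_pow, one_pow, Real.sq_sqrt zero_le_two,
      hZ.frobNorm_diagonal_sub_sq_eq hpn' μ (μ ⟨p, by omega⟩)] at hsq
    by_contra hnot
    have heq : μ ⟨p - 1, by omega⟩ = μ ⟨p, by omega⟩ :=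
      le_antisymm (not_lt.mp hnot) (hμ (Fin.mk_le_mk.mpr (Nat.sub_le p 1)))
    have hhalf := half_le_frobNorm_diagonal_sub_sq (p := p) (μ := μ)
      (i := ⟨p - 1, by omega⟩) (j := ⟨p, by omega⟩) (Nat.sub_lt hp1 one_pos) le_rfl heq
    have hsum := Finset.sum_nonneg fun i (_ : i ∈ Finset.univ) =>
      hZ.mul_firstIndicator_sub_nonneg (μ := μ) (c := μ ⟨p, by omega⟩)
        (fun i hi => hμ (Fin.le_def.mpr hi.le)) (fun i hi => hμ (Fin.le_def.mpr hi)) i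
    linarith
  refine ⟨hgap, fun X₁ X₂ hX₁ hX₂ hmin₁ hmin₂ => ?_⟩
  obtain ⟨Q, μ, hQ, hμ, hYQ⟩ := exists_antitone_spectral_decomposition hY
  obtain ⟨c, hc₁, hc₂⟩ := exists_between (hgap Q μ hQ hμ hYQ)
  subst hYQ
  have hlt : ∀ i : Fin n, (i : ℕ) < p → c < μ i := fun i hi =>
    hc₂.trans_le (hμ (Fin.le_def.mpr (Nat.le_sub_one_of_lt hi)))
  have hge : ∀ i : Fin n, p ≤ (i : ℕ) → μ i < c := fun i hi =>
    (hμ (Fin.le_def.mpr hi)).trans_lt hc₁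
  rw [hX₁.eq_of_forall_frobNorm_le hQ hpn' hlt hge hmin₁,
    hX₂.eq_of_forall_frobNorm_le hQ hpn' hlt hge hmin₂]
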